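/- Let $t_w > 0$ be a real period, $\epsilon > 0$ a real measurement delay, and $n \ge 1$ an integer. Define the delayed cardinality estimate $\hat{n}_\epsilon = t_w/\big(t_w/(n+1) + \epsilon\big) - 1$, the relative estimation error $e_n = (\hat{n}_\epsilon - n)/n$, the quantity $\rho = \epsilon(n+1)/t_w$, and $\Phi = -\rho/(1+\rho)$. Then $e_n = \frac{n+1}{n}\,\Phi$, and consequently the two-sided bound $2\Phi \le e_n \le \Phi < 0$ holds for every integer $n \ge 1$; that is, $e_n = \Theta\big(-\rho/(1+\rho)\big)$. -/

import Mathlib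

/-- Timing-error bound for the Estreme cardinality estimator (Proposition 1 of the
Estreme chapter): with wake-up period `tw > 0`, measurement delay `ε > 0` and true
cardinality `n ≥ 1`, the relative error `e_n` of the delayed estimate equals
`(n+1)/n · Φ` where `Φ = -ρ/(1+ρ)` and `ρ = ε(n+1)/tw`; consequently
`2Φ ≤ e_n ≤ Φ < 0`, i.e. `e_n = Θ(-ρ/(1+ρ))`. -/
theorem estreme_timing_error_theta
    (tw ε : ℝ) (n : ℕ) (htw : 0 < tw) (hε : 0 < ε) (hn : 1 ≤ n)
    (nhat : ℝ) (hnhat : nhat = tw / (tw / ((n : ℝ) + 1) + ε) - 1)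
    (e : ℝ) (he : e = (nhat - (n : ℝ)) / (n : ℝ))
    (ρ : ℝ) (hρ : ρ = ε * ((n : ℝ) + 1) / tw)
    (Φ : ℝ) (hΦ : Φ = -ρ / (1 + ρ)) :
    e = (((n : ℝ) + 1) / (n : ℝ)) * Φ ∧ 2 * Φ ≤ e ∧ e ≤ Φ ∧ Φ < 0 := by
  have hn1 : (1 : ℝ) ≤ (n : ℝ) := by exact_mod_cast hn
  have hn0 : (0 : ℝ) < (n : ℝ) := by linarith
  have hρ0 : 0 < ρ := by rw [hρ]; positivity
  have hΦ0 : Φ < 0 := by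
    rw [hΦ]
    exact div_neg_of_neg_of_pos (by linarith) (by linarith)
  have hε' : ε = ρ * tw / ((n : ℝ) + 1) := by
    rw [hρ]; field_simp
  have h1 : tw / (tw / ((n : ℝ) + 1) + ε) = ((n : ℝ) + 1) / (1 + ρ) := by
    have h2 : tw / ((n : ℝ) + 1) + ε = tw * (1 + ρ) / ((n : ℝ) + 1) := by
      rw [hε']; ring
    have h3 : 1 + ρ ≠ 0 := by linarith
    rw [h2]; field_simp
  have key : e = (((n : ℝ) + 1) / (n : ℝ)) * Φ := by
    have h3 : 1 + ρ ≠ 0 := by linarith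
    rw [he, hnhat, h1, hΦ]
    field_simp
    ring
  have hc : e = Φ + (1 / (n : ℝ)) * Φ := by
    rw [key]; field_simp
  have hi0 : 0 < 1 / (n : ℝ) := by positivity
  have hi1 : 1 / (n : ℝ) ≤ 1 := by
    rw [div_le_one hn0]; exact hn1
  refine ⟨key, ?_, ?_, hΦ0⟩
  · rw [hc]; nlinarith
  · rw [hc]; nlinarith
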